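/- Let q be a nonzero real number and x, y > 0 be such that xy ≠ 1, x^q + y^q ≠ 2 and x ≠ y (hence √(xy) ≠ ((x^q + y^q)/2)^{1/q}). For θ ∈ ℝ, let A = diag(1, x) and B_θ = R_θ diag(1, y) R_θᵀ, where R_θ is the 2×2 rotation matrix with first column (cos θ, sin θ) and second column (−sin θ, cos θ). Define the constant C := −(1/2)·[ (log x · log y)/log(xy) + (1−x^q)(1−y^q)/(q(2−x^q−y^q)) ]·[ ((x^q+y^q)/2)^{1/q} − √(xy) ] − [ (log y)/log(xy) − (1−y^q)/(2−x^q−y^q) ]²·(1 − √(xy))·[ 1 − ((x^q+y^q)/2)^{1/q} ]. Then det( ((A^q + B_θ^q)/2)^{1/q} − exp((log A + log B_θ)/2) ) = C·θ² + o(θ²) as θ → 0. -/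

import Mathlib

open scoped ComplexOrder

/-- Real functional calculus for Hermitian complex matrices, via the spectral theorem
(junk value `0` for non-Hermitian matrices). -/
noncomputable def Matrix.cfcReal {n : Type*} [Fintype n] [DecidableEq n]
    (f : ℝ → ℝ) (A : Matrix n n ℂ) : Matrix n n ℂ :=
  if hA : A.IsHermitian then
    (hA.eigenvectorUnitary : Matrix n n ℂ) *
      Matrix.diagonal (fun i => (f (hA.eigenvalues i) : ℂ)) *
      star (hA.eigenvectorUnitary : Matrix n n ℂ)
  else 0

/-- The real power `A ^ r` of a Hermitian (in particular, positive definite) matrix,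
defined by functional calculus, with the conventions `0 ^ r = 0` for `r ≠ 0` and `x ^ 0 = 1`. -/
noncomputable def Matrix.rpowH {n : Type*} [Fintype n] [DecidableEq n]
    (A : Matrix n n ℂ) (r : ℝ) : Matrix n n ℂ :=
  Matrix.cfcReal (fun t => t ^ r) A

/-- The logarithm of a positive definite matrix, by functional calculus. -/
noncomputable def Matrix.logH {n : Type*} [Fintype n] [DecidableEq n]
    (A : Matrix n n ℂ) : Matrix n n ℂ :=
  Matrix.cfcReal Real.log A

/-- The exponential of a Hermitian matrix, by functional calculus. -/
noncomputable def Matrix.expH {n : Type*} [Fintype n] [DecidableEq n]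
    (A : Matrix n n ℂ) : Matrix n n ℂ :=
  Matrix.cfcReal Real.exp A

open Asymptotics Matrix

/-- The `2 × 2` rotation matrix by angle `θ`, as a complex matrix. -/
noncomputable def rotC (θ : ℝ) : Matrix (Fin 2) (Fin 2) ℂ :=
  !![(Real.cos θ : ℂ), -(Real.sin θ : ℂ); (Real.sin θ : ℂ), (Real.cos θ : ℂ)]

/-- The constant `C` in the second-order expansion of Lemma 3.2. -/
noncomputable def lemmaConst₀ (q x y : ℝ) : ℝ :=
  -(1 / 2) *
      ((Real.log x * Real.log y) / Real.log (x * y) +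
        (1 - x ^ q) * (1 - y ^ q) / (q * (2 - x ^ q - y ^ q))) *
      (((x ^ q + y ^ q) / 2) ^ (1 / q) - Real.sqrt (x * y)) -
    (Real.log y / Real.log (x * y) - (1 - y ^ q) / (2 - x ^ q - y ^ q)) ^ 2 *
      (1 - Real.sqrt (x * y)) * (1 - ((x ^ q + y ^ q) / 2) ^ (1 / q))

/-- Real symmetric `2 × 2` matrix, viewed as a complex matrix. -/
noncomputable def symm2 (a b c : ℝ) : Matrix (Fin 2) (Fin 2) ℂ :=
  !![(a : ℂ), (b : ℂ); (b : ℂ), (c : ℂ)]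

lemma symm2_isHermitian (a b c : ℝ) : (symm2 a b c).IsHermitian := by
  ext i j
  fin_cases i <;> fin_cases j <;> simp [symm2]

lemma cfcReal_affine {A : Matrix (Fin 2) (Fin 2) ℂ} (hA : A.IsHermitian) (f : ℝ → ℝ) (α β : ℝ)
    (h : ∀ i, f (hA.eigenvalues i) = α * hA.eigenvalues i + β) :
    Matrix.cfcReal f A = (α : ℂ) • A + (β : ℂ) • (1 : Matrix (Fin 2) (Fin 2) ℂ) := by
  have hs := hA.spectral_theorem
  rw [Unitary.conjStarAlgAut_apply] at hs
  have hu : (hA.eigenvectorUnitary : Matrix (Fin 2) (Fin 2) ℂ) *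
      star (hA.eigenvectorUnitary : Matrix (Fin 2) (Fin 2) ℂ) = 1 :=
    Unitary.mul_star_self_of_mem hA.eigenvectorUnitary.2
  have hd : Matrix.diagonal (fun i => (f (hA.eigenvalues i) : ℂ)) =
      (α : ℂ) • Matrix.diagonal (RCLike.ofReal ∘ hA.eigenvalues : Fin 2 → ℂ) +
        (β : ℂ) • (1 : Matrix (Fin 2) (Fin 2) ℂ) := by
    ext i j
    by_cases hij : i = j
    · subst hij
      simp [h]
    · simp [hij]
  rw [Matrix.cfcReal, dif_pos hA, hd]
  conv_rhs => rw [hs]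
  rw [Matrix.mul_add, Matrix.add_mul]
  simp only [Matrix.mul_smul, Matrix.smul_mul, Matrix.mul_one]
  rw [hu]

lemma cfcReal_symm2 (f : ℝ → ℝ) (a b c p r α β : ℝ) (ht : a + c = p + r)
    (hd : a * c - b * b = p * r) (hp : f p = α * p + β) (hr : f r = α * r + β) :
    Matrix.cfcReal f (symm2 a b c) = symm2 (α * a + β) (α * b) (α * c + β) := by
  have hA := symm2_isHermitian a b c
  have h1 := hA.trace_eq_sum_eigenvalues
  have h2 := hA.det_eq_prod_eigenvalues
  have h1' : a + c = hA.eigenvalues 0 + hA.eigenvalues 1 := by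
    have : ((a + c : ℝ) : ℂ) = ((hA.eigenvalues 0 + hA.eigenvalues 1 : ℝ) : ℂ) := by
      simpa [symm2, Matrix.trace, Fin.sum_univ_two] using h1
    exact_mod_cast this
  have h2' : a * c - b * b = hA.eigenvalues 0 * hA.eigenvalues 1 := by
    have : ((a * c - b * b : ℝ) : ℂ) = ((hA.eigenvalues 0 * hA.eigenvalues 1 : ℝ) : ℂ) := by
      simpa [symm2, Matrix.det_fin_two, Fin.prod_univ_two] using h2
    exact_mod_cast this
  have key : ∀ t : ℝ, (t - p) * (t - r) = 0 → f t = α * t + β := by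
    intro t h
    rcases mul_eq_zero.1 h with h | h
    · rw [sub_eq_zero.1 h, hp]
    · rw [sub_eq_zero.1 h, hr]
  rw [cfcReal_affine hA f α β]
  · ext i j
    fin_cases i <;> fin_cases j <;> simp [symm2]
  · intro i
    apply key
    fin_cases i
    · show (hA.eigenvalues 0 - p) * (hA.eigenvalues 0 - r) = 0
      linear_combination hA.eigenvalues 0 * ht - hA.eigenvalues 0 * h1' - hd + h2'
    · show (hA.eigenvalues 1 - p) * (hA.eigenvalues 1 - r) = 0
      linear_combination hA.eigenvalues 1 * ht - hA.eigenvalues 1 * h1' - hd + h2'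

/-- `R_θ diag(e, b) R_θᵀ`. -/
noncomputable def rotDiag (e b θ : ℝ) : Matrix (Fin 2) (Fin 2) ℂ :=
  symm2 (e - (e - b) * Real.sin θ ^ 2) ((e - b) * (Real.cos θ * Real.sin θ))
    (b + (e - b) * Real.sin θ ^ 2)

lemma rotDiag_eq (y θ : ℝ) :
    rotC θ * Matrix.diagonal ![1, (y : ℂ)] * (rotC θ)ᵀ = rotDiag 1 y θ := by
  have h : (Real.cos θ : ℂ) ^ 2 = 1 - (Real.sin θ : ℂ) ^ 2 := by
    have := Real.cos_sq' θ
    exact_mod_cast this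
  have hdg : Matrix.diagonal ![1, (y : ℂ)] = !![1, 0; 0, (y : ℂ)] := by
    ext i j
    fin_cases i <;> fin_cases j <;> simp
  rw [hdg]
  ext i j
  fin_cases i <;> fin_cases j <;>
    simp [rotC, rotDiag, symm2, Matrix.mul_apply, Fin.sum_univ_two, -Complex.ofReal_cos,
      -Complex.ofReal_sin]
  · linear_combination h
  · ring
  · ring
  · linear_combination (y : ℂ) * h

lemma diag_eq (x : ℝ) : Matrix.diagonal ![1, (x : ℂ)] = rotDiag 1 x 0 := by
  ext i j
  fin_cases i <;> fin_cases j <;> simp [rotDiag, symm2]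

lemma cfcReal_rotDiag (f : ℝ → ℝ) (e b θ : ℝ) :
    Matrix.cfcReal f (rotDiag e b θ) = rotDiag (f e) (f b) θ := by
  have hc := Real.cos_sq' θ
  obtain ⟨α, hα⟩ : ∃ α, f e - f b = α * (e - b) := by
    by_cases h : e = b
    · exact ⟨0, by simp [h]⟩
    · exact ⟨(f e - f b) / (e - b), by field_simp [sub_ne_zero.2 h]⟩
  rw [rotDiag, cfcReal_symm2 f _ _ _ e b α (f e - α * e) (by ring)
    (by linear_combination (-(e - b) ^ 2 * Real.sin θ ^ 2) * hc) (by ring)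
    (by linear_combination -hα), rotDiag]
  congr 1
  · linear_combination Real.sin θ ^ 2 * hα
  · linear_combination (-(Real.cos θ * Real.sin θ)) * hα
  · linear_combination (1 - Real.sin θ ^ 2) * hα

lemma sin_eq_mul_sinc (θ : ℝ) : Real.sin θ = θ * Real.sinc θ := by
  by_cases h : θ = 0
  · simp [h]
  · rw [Real.sinc_of_ne_zero h]; field_simp

lemma mean_expansion (f : ℝ → ℝ) (f' e a b : ℝ) (hne : 2 * e - a - b ≠ 0)
    (hf : HasDerivAt f f' e) (hm : ContinuousAt f ((a + b) / 2)) :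
    ∃ h11 h12 h22 : ℝ → ℝ, ContinuousAt h11 0 ∧ ContinuousAt h12 0 ∧ ContinuousAt h22 0 ∧
      h11 0 = -f' * ((e - a) * (e - b)) / (2 * (2 * e - a - b)) -
        (f e - f ((a + b) / 2)) * (e - b) ^ 2 / (2 * e - a - b) ^ 2 ∧
      h12 0 = (f e - f ((a + b) / 2)) * (e - b) / (2 * e - a - b) ∧
      h22 0 = f ((a + b) / 2) ∧
      ∀ᶠ θ in nhds (0 : ℝ), Matrix.cfcReal f ((2 : ℂ)⁻¹ • (rotDiag e a 0 + rotDiag e b θ)) =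
        symm2 (f e + θ ^ 2 * h11 θ) (θ * h12 θ) (h22 θ) := by
  obtain ⟨m, hmdef⟩ : ∃ m, m = (a + b) / 2 := ⟨_, rfl⟩
  rw [← hmdef] at hm ⊢
  obtain ⟨d, hd⟩ : ∃ d, d = e - m := ⟨_, rfl⟩
  have hd0 : d ≠ 0 := by
    intro h
    apply hne
    linarith
  have h2d : 2 * e - a - b = 2 * d := by linarith
  rw [h2d]
  obtain ⟨w, hw⟩ : ∃ w, w = (e - a) * (e - b) / 4 := ⟨_, rfl⟩
  obtain ⟨u, hu⟩ : ∃ u, u = (e - b) / 2 := ⟨_, rfl⟩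
  obtain ⟨δ, hδ⟩ : ∃ δ : ℝ → ℝ, δ = fun θ =>
    d / 2 * (-1 + Real.sqrt (1 - 4 * w * Real.sin θ ^ 2 / d ^ 2)) := ⟨_, rfl⟩
  have hδc : ContinuousAt δ 0 := by
    rw [hδ]
    apply Continuous.continuousAt
    fun_prop
  have hδ0 : δ 0 = 0 := by simp [hδ]
  have hev1 : ∀ᶠ θ in nhds (0 : ℝ), 0 ≤ 1 - 4 * w * Real.sin θ ^ 2 / d ^ 2 := by
    have hc : ContinuousAt (fun θ => 1 - 4 * w * Real.sin θ ^ 2 / d ^ 2) 0 := by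
      apply Continuous.continuousAt
      fun_prop
    filter_upwards [hc.eventually (lt_mem_nhds (a := 0) (by simp))] with θ h using h.le
  have hev2 : ∀ᶠ θ in nhds (0 : ℝ), d + δ θ ≠ 0 :=
    (continuousAt_const.add hδc).eventually_ne (by simpa [hδ0] using hd0)
  have hev3 : ∀ᶠ θ in nhds (0 : ℝ), d + 2 * δ θ ≠ 0 :=
    (continuousAt_const.add (continuousAt_const.mul hδc)).eventually_ne
      (by simpa [hδ0] using hd0)
  obtain ⟨η, hη⟩ : ∃ η : ℝ → ℝ, η = fun θ => -w * Real.sinc θ ^ 2 / (d + δ θ) := ⟨_, rfl⟩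
  have hsc : ContinuousAt Real.sinc 0 := Real.continuous_sinc.continuousAt
  have hηc : ContinuousAt η 0 := by
    rw [hη]
    exact (continuousAt_const.mul (hsc.pow 2)).div (continuousAt_const.add hδc)
      (by simpa [hδ0] using hd0)
  have hη0 : η 0 = -w / d := by simp [hη, hδ0]
  have hc1 : ContinuousAt (fun θ => e + δ θ) 0 := continuousAt_const.add hδc
  have hc2 : ContinuousAt (fun θ => m - δ θ) 0 := continuousAt_const.sub hδc
  have hfc1 : ContinuousAt (fun θ => f (e + δ θ)) 0 := by
    apply ContinuousAt.comp (g := f) _ hc1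
    simpa [hδ0] using hf.continuousAt
  have hfc2 : ContinuousAt (fun θ => f (m - δ θ)) 0 := by
    apply ContinuousAt.comp (g := f) _ hc2
    simpa [hδ0] using hm
  have hsl : ContinuousAt (fun θ => dslope f e (e + δ θ)) 0 := by
    apply ContinuousAt.comp (g := dslope f e) _ hc1
    simpa [hδ0] using hf.differentiableAt
  obtain ⟨k, hk⟩ : ∃ k : ℝ → ℝ, k = fun θ => (f (e + δ θ) - f (m - δ θ)) / (d + 2 * δ θ) :=
    ⟨_, rfl⟩
  have hkc : ContinuousAt k 0 := by
    rw [hk]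
    exact (hfc1.sub hfc2).div (continuousAt_const.add (continuousAt_const.mul hδc))
      (by simpa [hδ0] using hd0)
  have hk0 : k 0 = (f e - f m) / d := by simp [hk, hδ0]
  have hsin : ContinuousAt Real.sin 0 := Real.continuous_sin.continuousAt
  have hcos : ContinuousAt Real.cos 0 := Real.continuous_cos.continuousAt
  have heb : e - b = 2 * u := by linarith
  have hea : e - a = 2 * (d - u) := by linarith
  have hwu : w = (d - u) * u := by rw [hw, heb, hea]; ring
  refine ⟨fun θ => dslope f e (e + δ θ) * η θ + k θ * (-u * Real.sinc θ ^ 2 - η θ),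
    fun θ => k θ * u * Real.cos θ * Real.sinc θ,
    fun θ => f (e + δ θ) + k θ * (m + u * Real.sin θ ^ 2 - e - δ θ), ?_, ?_, ?_, ?_, ?_, ?_, ?_⟩
  · exact (hsl.mul hηc).add (hkc.mul ((continuousAt_const.mul (hsc.pow 2)).sub hηc))
  · exact ((hkc.mul continuousAt_const).mul hcos).mul hsc
  · exact hfc1.add (hkc.mul (((continuousAt_const.add
      (continuousAt_const.mul (hsin.pow 2))).sub continuousAt_const).sub hδc))
  · simp only [hδ0, hη0, hk0, add_zero, dslope_same, hf.deriv, Real.sinc_zero]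
    rw [heb, hea, hwu]
    field_simp
    ring
  · simp only [hk0, Real.sinc_zero, Real.cos_zero, heb]
    field_simp
  · simp only [hδ0, hk0, Real.sin_zero]
    have : m + u * 0 ^ 2 - e - 0 = -d := by rw [hd]; ring
    rw [this, add_zero]
    field_simp
    ring
  · filter_upwards [hev1, hev2, hev3] with θ h1 h2 h3
    have hq : δ θ * (d + δ θ) = -w * Real.sin θ ^ 2 := by
      have hsq := Real.sq_sqrt h1
      have e1 : δ θ * (d + δ θ) =
          d ^ 2 / 4 * (Real.sqrt (1 - 4 * w * Real.sin θ ^ 2 / d ^ 2) ^ 2 - 1) := by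
        rw [hδ]; ring
      rw [e1, hsq]
      field_simp
      ring
    have hδη : δ θ = θ ^ 2 * η θ := by
      have : η θ = -w * Real.sinc θ ^ 2 / (d + δ θ) := by rw [hη]
      rw [this]
      rw [sin_eq_mul_sinc] at hq
      field_simp
      linear_combination hq
    have hmat : (2 : ℂ)⁻¹ • (rotDiag e a 0 + rotDiag e b θ) =
        symm2 (e - u * Real.sin θ ^ 2) (u * (Real.cos θ * Real.sin θ))
          (m + u * Real.sin θ ^ 2) := by
      rw [hu, hmdef]
      ext i j
      fin_cases i <;> fin_cases j <;>
        simp [rotDiag, symm2, -Complex.ofReal_cos, -Complex.ofReal_sin] <;> ring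
    have hkk : k θ * (d + 2 * δ θ) = f (e + δ θ) - f (m - δ θ) := by
      rw [hk]; exact div_mul_cancel₀ _ h3
    have hc := Real.cos_sq' θ
    have hds := sub_smul_dslope f e (e + δ θ)
    rw [smul_eq_mul] at hds
    rw [hmat, cfcReal_symm2 f _ _ _ (e + δ θ) (m - δ θ) (k θ) (f (e + δ θ) - k θ * (e + δ θ))
      (by ring)
      (by
        rw [hwu] at hq
        have hm' : m = e - d := by linarith
        rw [hm']
        linear_combination hq - u ^ 2 * Real.sin θ ^ 2 * hc) (by ring)
      (by
        have hm' : e = m + d := by linarith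
        linear_combination hkk + k θ * hm')]
    congr 1
    · rw [sin_eq_mul_sinc]
      linear_combination -hds + (dslope f e (e + δ θ) - k θ) * hδη
    · rw [sin_eq_mul_sinc]
      ring
    · ring

/-- Lemma 3.2: with `A = diag(1, x)` and `B_θ = R_θ diag(1, y) R_θᵀ`, one has
`det(((A^q + B_θ^q)/2)^(1/q) − exp((log A + log B_θ)/2)) = C θ² + o(θ²)` as `θ → 0`. -/
theorem det_powerMean_logEuclidean_expansion (q x y : ℝ) (hq : q ≠ 0)
    (hx : 0 < x) (hy : 0 < y)
    (h1 : x * y ≠ 1) (h2 : x ^ q + y ^ q ≠ 2) (h3 : x ≠ y) :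
    (fun θ : ℝ =>
        (Matrix.rpowH ((2 : ℂ)⁻¹ • (Matrix.rpowH (Matrix.diagonal ![1, (x : ℂ)]) q +
              Matrix.rpowH (rotC θ * Matrix.diagonal ![1, (y : ℂ)] * (rotC θ)ᵀ) q)) (1 / q) -
          Matrix.expH ((2 : ℂ)⁻¹ • (Matrix.logH (Matrix.diagonal ![1, (x : ℂ)]) +
              Matrix.logH (rotC θ * Matrix.diagonal ![1, (y : ℂ)] * (rotC θ)ᵀ)))).det -
        (lemmaConst₀ q x y : ℂ) * (θ : ℂ) ^ 2)
      =o[nhds (0 : ℝ)] (fun θ : ℝ => θ ^ 2) := by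
  have hxq : 0 < x ^ q := Real.rpow_pos_of_pos hx q
  have hyq : 0 < y ^ q := Real.rpow_pos_of_pos hy q
  have hL : Real.log (x * y) = Real.log x + Real.log y := Real.log_mul hx.ne' hy.ne'
  have hL0 : Real.log (x * y) ≠ 0 := Real.log_ne_zero_of_pos_of_ne_one (mul_pos hx hy) h1
  have hD0 : 2 - x ^ q - y ^ q ≠ 0 := by
    intro h
    apply h2
    linarith
  have hm0 : 0 < (x ^ q + y ^ q) / 2 := by positivity
  have hder : HasDerivAt (fun t : ℝ => t ^ (1 / q)) (1 / q) 1 := by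
    simpa using Real.hasDerivAt_rpow_const (x := 1) (p := 1 / q) (Or.inl one_ne_zero)
  obtain ⟨p11, p12, p22, cp11, cp12, cp22, vp11, vp12, vp22, hP⟩ :=
    mean_expansion (fun t : ℝ => t ^ (1 / q)) (1 / q) 1 (x ^ q) (y ^ q)
      (by simpa using hD0) hder (Real.continuousAt_rpow_const _ _ (Or.inl hm0.ne'))
  have hexp : HasDerivAt Real.exp 1 0 := by simpa using Real.hasDerivAt_exp 0
  obtain ⟨r11, r12, r22, cr11, cr12, cr22, vr11, vr12, vr22, hR⟩ :=
    mean_expansion Real.exp 1 0 (Real.log x) (Real.log y)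
      (by intro h; apply hL0; rw [hL]; linarith) hexp Real.continuous_exp.continuousAt
  have hG : Real.exp ((Real.log x + Real.log y) / 2) = Real.sqrt (x * y) := by
    rw [← hL, Real.sqrt_eq_rpow, Real.rpow_def_of_pos (mul_pos hx hy)]
    congr 1
    ring
  obtain ⟨H, hH⟩ : ∃ H : ℝ → ℝ, H = fun θ =>
    (p11 θ - r11 θ) * (p22 θ - r22 θ) - (p12 θ - r12 θ) ^ 2 := ⟨_, rfl⟩
  have hHc : ContinuousAt H 0 := by
    rw [hH]
    exact ((cp11.sub cr11).mul (cp22.sub cr22)).sub ((cp12.sub cr12).pow 2)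
  have hH0 : H 0 = lemmaConst₀ q x y := by
    simp only [hH, vp11, vp12, vp22, vr11, vr12, vr22, lemmaConst₀, hG, Real.exp_zero,
      Real.one_rpow]
    have e1 : (2 : ℝ) * 0 - Real.log x - Real.log y = -Real.log (x * y) := by rw [hL]; ring
    rw [e1, mul_one]
    generalize ((x ^ q + y ^ q) / 2) ^ (1 / q) = F
    generalize Real.sqrt (x * y) = G
    generalize Real.log (x * y) = L at *
    generalize x ^ q = a at *
    generalize y ^ q = b at *
    generalize hDD : 2 - a - b = D at *
    field_simp
    ring
  have hlim : (fun θ : ℝ => (((H θ - lemmaConst₀ q x y) * θ ^ 2 : ℝ) : ℂ))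
      =o[nhds (0 : ℝ)] (fun θ : ℝ => θ ^ 2) := by
    have ho : (fun θ : ℝ => H θ - lemmaConst₀ q x y) =o[nhds (0 : ℝ)] (fun _ => (1 : ℝ)) := by
      rw [Asymptotics.isLittleO_one_iff]
      have := hHc.tendsto.sub_const (lemmaConst₀ q x y)
      rwa [hH0, sub_self] at this
    have h := ho.mul_isBigO (Asymptotics.isBigO_refl (fun θ : ℝ => θ ^ 2) (nhds 0))
    simp only [one_mul] at h
    refine Asymptotics.IsLittleO.of_norm_left ?_
    simpa only [Complex.norm_real] using h.norm_left
  refine hlim.congr' ?_ Filter.EventuallyEq.rfl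
  filter_upwards [hP, hR] with θ hPθ hRθ
  have eP : Matrix.rpowH ((2 : ℂ)⁻¹ • (Matrix.rpowH (Matrix.diagonal ![1, (x : ℂ)]) q +
      Matrix.rpowH (rotC θ * Matrix.diagonal ![1, (y : ℂ)] * (rotC θ)ᵀ) q)) (1 / q) =
      symm2 (1 + θ ^ 2 * p11 θ) (θ * p12 θ) (p22 θ) := by
    simp only [Matrix.rpowH]
    rw [rotDiag_eq, diag_eq, cfcReal_rotDiag, cfcReal_rotDiag]
    simp only [Real.one_rpow] at hPθ ⊢
    exact hPθ
  have eR : Matrix.expH ((2 : ℂ)⁻¹ • (Matrix.logH (Matrix.diagonal ![1, (x : ℂ)]) +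
      Matrix.logH (rotC θ * Matrix.diagonal ![1, (y : ℂ)] * (rotC θ)ᵀ))) =
      symm2 (1 + θ ^ 2 * r11 θ) (θ * r12 θ) (r22 θ) := by
    simp only [Matrix.expH, Matrix.logH]
    rw [rotDiag_eq, diag_eq, cfcReal_rotDiag, cfcReal_rotDiag]
    simp only [Real.log_one, Real.exp_zero] at hRθ ⊢
    exact hRθ
  rw [eP, eR, hH]
  simp [symm2, Matrix.det_fin_two]
  ring
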